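/- arXiv:1806.00519 — 3 statements merged into one kernel-verified Lean document; each statement's English description precedes it below -/
import Mathlib

section
/- Let x̂ ∈ X be a generalized mode of μ. Then x̂ is a strong mode of μ if and only if for every sequence {δ_n} of positive reals with δ_n → 0 there exists a sequence {w_n} ⊂ X with w_n → x̂ in X, lim_{n→∞} μ(B^{δ_n}(w_n))/M^{δ_n} = 1, and lim_{n→∞} μ(B^{δ_n}(x̂))/μ(B^{δ_n}(w_n)) = 1. -/
open MeasureTheory Metric Filter Topology

/-- The maximal probability of an open ball of radius `δ` under `μ`. -/
noncomputable def maxBallProb {X : Type*} [PseudoMetricSpace X] [MeasurableSpace X]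
    (μ : Measure X) (δ : ℝ) : ℝ :=
  ⨆ x : X, (μ (ball x δ)).toReal

/-- `xhat` is a strong mode of `μ` if `μ(B^δ(xhat))/M^δ → 1` as `δ → 0⁺`. -/
def IsStrongMode {X : Type*} [PseudoMetricSpace X] [MeasurableSpace X]
    (μ : Measure X) (xhat : X) : Prop :=
  Tendsto (fun δ : ℝ => (μ (ball xhat δ)).toReal / maxBallProb μ δ) (𝓝[>] (0 : ℝ)) (𝓝 1)

/-- `xhat` is a generalized mode of `μ` if for every positive sequence `δ_n → 0` there is an
approximating sequence `w_n → xhat` with `μ(B^{δ_n}(w_n))/M^{δ_n} → 1`. -/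
def IsGeneralizedMode {X : Type*} [PseudoMetricSpace X] [MeasurableSpace X]
    (μ : Measure X) (xhat : X) : Prop :=
  ∀ δ : ℕ → ℝ, (∀ n, 0 < δ n) → Tendsto δ atTop (𝓝 (0 : ℝ)) →
    ∃ w : ℕ → X, Tendsto w atTop (𝓝 xhat) ∧
      Tendsto (fun n => (μ (ball (w n) (δ n))).toReal / maxBallProb μ (δ n)) atTop (𝓝 1)


theorem strongMode_iff_ratio_condition {X : Type*} [NormedAddCommGroup X] [NormedSpace ℝ X]
    [CompleteSpace X] [TopologicalSpace.SeparableSpace X] [MeasurableSpace X] [BorelSpace X]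
    (μ : Measure X) [IsProbabilityMeasure μ] (xhat : X)
    (hgen : IsGeneralizedMode μ xhat) :
    IsStrongMode μ xhat ↔
      ∀ δ : ℕ → ℝ, (∀ n, 0 < δ n) → Tendsto δ atTop (𝓝 (0 : ℝ)) →
        ∃ w : ℕ → X, Tendsto w atTop (𝓝 xhat) ∧
          Tendsto (fun n => (μ (ball (w n) (δ n))).toReal / maxBallProb μ (δ n)) atTop (𝓝 1) ∧
          Tendsto (fun n => (μ (ball xhat (δ n))).toReal / (μ (ball (w n) (δ n))).toReal)
            atTop (𝓝 1) := by
  constructor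
  · intro h δ hpos hδ
    have hlim : Tendsto (fun n => (μ (ball xhat (δ n))).toReal / maxBallProb μ (δ n))
        atTop (𝓝 1) :=
      h.comp (tendsto_nhdsWithin_iff.2 ⟨hδ, Eventually.of_forall hpos⟩)
    refine ⟨fun _ => xhat, tendsto_const_nhds, hlim, ?_⟩
    refine tendsto_const_nhds.congr' ?_
    filter_upwards [hlim.eventually_ne one_ne_zero] with n hn
    exact (div_self (div_ne_zero_iff.1 hn).1).symm
  · intro h
    refine tendsto_of_seq_tendsto fun u hu => ?_
    obtain ⟨hu0, hupos⟩ := tendsto_nhdsWithin_iff.1 hu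
    obtain ⟨N, hN⟩ := eventually_atTop.1 hupos
    obtain ⟨w, -, hw, hratio⟩ := h (fun n => u (n + N)) (fun n => hN _ (Nat.le_add_left N n))
      ((tendsto_add_atTop_iff_nat N).2 hu0)
    refine (tendsto_add_atTop_iff_nat N).1 ?_
    have hmul := hratio.mul hw
    rw [one_mul] at hmul
    refine hmul.congr' ?_
    filter_upwards [hw.eventually_ne one_ne_zero] with n hn
    exact div_mul_div_cancel₀ (div_ne_zero_iff.1 hn).1
end

section
/- Let x̂ ∈ X be a generalized mode of μ. If there exists an r > 0 such that lim_{δ→0} μ(B^δ(x̂)) / sup_{w ∈ B^r(x̂)} μ(B^δ(w)) = 1, then x̂ is a strong mode of μ. -/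
open MeasureTheory Metric Filter Topology

section LocalSup

variable {X : Type*} [PseudoMetricSpace X] [MeasurableSpace X]

theorem ballProb_le_one (μ : Measure X) [IsProbabilityMeasure μ] (x : X) (δ : ℝ) :
    (μ (ball x δ)).toReal ≤ 1 :=
  measureReal_le_one

theorem ballProb_le_maxBallProb (μ : Measure X) [IsProbabilityMeasure μ] (x : X) (δ : ℝ) :
    (μ (ball x δ)).toReal ≤ maxBallProb μ δ :=
  le_ciSup (f := fun x : X => (μ (ball x δ)).toReal)
    ⟨1, by rintro _ ⟨y, rfl⟩; exact ballProb_le_one μ y δ⟩ x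

theorem maxBallProb_nonneg (μ : Measure X) (δ : ℝ) : 0 ≤ maxBallProb μ δ :=
  Real.iSup_nonneg fun _ => ENNReal.toReal_nonneg

theorem localSup_le_maxBallProb (μ : Measure X) [IsProbabilityMeasure μ] (s : Set X) (δ : ℝ) :
    ⨆ w ∈ s, (μ (ball w δ)).toReal ≤ maxBallProb μ δ :=
  Real.iSup_le (fun w => Real.iSup_le (fun _ => ballProb_le_maxBallProb μ w δ)
    (maxBallProb_nonneg μ δ)) (maxBallProb_nonneg μ δ)

theorem ballProb_le_localSup (μ : Measure X) [IsProbabilityMeasure μ] {s : Set X} {x : X}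
    (hx : x ∈ s) (δ : ℝ) :
    (μ (ball x δ)).toReal ≤ ⨆ w ∈ s, (μ (ball w δ)).toReal := by
  refine le_ciSup_of_le (f := fun w : X => ⨆ _ : w ∈ s, (μ (ball w δ)).toReal)
    ⟨1, ?_⟩ x ?_
  · rintro _ ⟨y, rfl⟩
    exact Real.iSup_le (fun _ => ballProb_le_one μ y δ) zero_le_one
  · exact (ciSup_pos (f := fun _ : x ∈ s => (μ (ball x δ)).toReal) hx).ge

end LocalSup

theorem strongMode_of_localSup {X : Type*} [NormedAddCommGroup X] [NormedSpace ℝ X]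
    [CompleteSpace X] [TopologicalSpace.SeparableSpace X] [MeasurableSpace X] [BorelSpace X]
    (μ : Measure X) [IsProbabilityMeasure μ] (xhat : X)
    (hgen : IsGeneralizedMode μ xhat) (r : ℝ) (hr : 0 < r)
    (hlim : Tendsto
      (fun δ : ℝ => (μ (ball xhat δ)).toReal / ⨆ w ∈ ball xhat r, (μ (ball w δ)).toReal)
      (𝓝[>] (0 : ℝ)) (𝓝 1)) :
    IsStrongMode μ xhat := by
  refine tendsto_of_seq_tendsto fun u hu => ?_
  have hpos : ∀ᶠ n in atTop, 0 < u n := hu.eventually self_mem_nhdsWithin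
  obtain ⟨N, hN⟩ := eventually_atTop.mp hpos
  refine (tendsto_add_atTop_iff_nat N).mp ?_
  have hv : Tendsto (fun n => u (n + N)) atTop (𝓝[>] (0 : ℝ)) :=
    hu.comp (tendsto_add_atTop_nat N)
  obtain ⟨w, hw, hwlim⟩ := hgen (fun n => u (n + N)) (fun n => hN _ (Nat.le_add_left N n))
    (hv.mono_right nhdsWithin_le_nhds)
  have hloc := hlim.comp hv
  have hsup : Tendsto (fun n => (⨆ x ∈ ball xhat r, (μ (ball x (u (n + N)))).toReal) /
      maxBallProb μ (u (n + N))) atTop (𝓝 1) := by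
    refine tendsto_of_tendsto_of_tendsto_of_le_of_le' hwlim tendsto_const_nhds ?_ ?_
    · filter_upwards [hw.eventually (ball_mem_nhds xhat hr)] with n hn
      exact div_le_div_of_nonneg_right (ballProb_le_localSup μ hn _) (maxBallProb_nonneg μ _)
    · exact Eventually.of_forall fun n =>
        div_le_one_of_le₀ (localSup_le_maxBallProb μ _ _) (maxBallProb_nonneg μ _)
  have hprod := hloc.mul hsup
  rw [one_mul] at hprod
  refine hprod.congr' ?_
  filter_upwards [hloc.eventually_ne one_ne_zero] with n hn
  exact div_mul_div_cancel₀ (div_ne_zero_iff.mp hn).2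
end

section
/- Let μ be a centered Gaussian Borel probability measure on a separable Banach space X. Then the origin 0 ∈ X is both a strong mode and a generalized mode of μ, whereas every x ∈ X with x ≠ 0 is neither a strong mode nor a generalized mode of μ. -/
open MeasureTheory Metric Filter Topology

/-- `μ` is a centered Gaussian measure on `X`: the pushforward of `μ` under every continuous
linear functional is a centered Gaussian distribution on `ℝ`. -/
def IsCenteredGaussianMeasure {X : Type*} [NormedAddCommGroup X] [NormedSpace ℝ X]
    [MeasurableSpace X] (μ : Measure X) : Prop :=
  ∀ L : X →L[ℝ] ℝ, ∃ v : NNReal, μ.map L = ProbabilityTheory.gaussianReal 0 v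

open ProbabilityTheory
open scoped ENNReal Pointwise

lemma volume_add_le_of_add_subset {A B C : Set ℝ} (hA : MeasurableSet A) (hB : MeasurableSet B)
    (hA0 : A.Nonempty) (hB0 : B.Nonempty) (h : ∀ a ∈ A, ∀ b ∈ B, a + b ∈ C) :
    volume A + volume B ≤ volume C := by
  have key : ∀ K ⊆ A, IsCompact K → K.Nonempty → ∀ L ⊆ B, IsCompact L → L.Nonempty →
      volume K + volume L ≤ volume C := by
    intro K hK hKc hK0 L hL hLc hL0
    obtain ⟨a, haK, ha⟩ := hKc.exists_isGreatest hK0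
    obtain ⟨b, hbL, hb⟩ := hLc.exists_isLeast hL0
    have hd : AEDisjoint volume ((fun x => x + b) '' K) ((fun x => a + x) '' L) := by
      refine measure_mono_null (t := {a + b}) ?_ (by simp)
      rintro _ ⟨⟨x, hx, rfl⟩, ⟨y, hy, hxy⟩⟩
      have h1 := ha hx
      have h2 := hb hy
      simp only [Set.mem_singleton_iff] at *
      linarith
    have hm : MeasurableSet ((fun x => a + x) '' L) :=
      (hLc.image (by fun_prop)).isClosed.measurableSet
    calc volume K + volume L
        = volume ((fun x => x + b) '' K) + volume ((fun x => a + x) '' L) := by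
          simp [Set.image_add_left, Set.image_add_right]
      _ = volume ((fun x => x + b) '' K ∪ (fun x => a + x) '' L) :=
          (measure_union₀ hm.nullMeasurableSet hd).symm
      _ ≤ volume C := by
          refine measure_mono ?_
          rintro _ (⟨x, hx, rfl⟩ | ⟨y, hy, rfl⟩)
          · exact h _ (hK hx) _ (hL hbL)
          · exact h _ (hK haK) _ (hL hy)
  have key' : ∀ K ⊆ A, IsCompact K → ∀ L ⊆ B, IsCompact L → volume K + volume L ≤ volume C := by
    intro K hK hKc L hL hLc
    obtain ⟨a, ha⟩ := hA0
    obtain ⟨b, hb⟩ := hB0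
    refine le_trans ?_ (key (insert a K) (Set.insert_subset ha hK) (hKc.insert a)
      (Set.insert_nonempty _ _) (insert b L) (Set.insert_subset hb hL) (hLc.insert b)
      (Set.insert_nonempty _ _))
    gcongr <;> exact Set.subset_insert _ _
  rw [hA.measure_eq_iSup_isCompact, hB.measure_eq_iSup_isCompact]
  simp only [iSup_and']
  refine ENNReal.biSup_add_biSup_le' ⟨∅, by simp⟩ ⟨∅, by simp⟩ ?_
  exact fun K hK L hL => key' K hK.1 hK.2 L hL.1 hL.2

lemma lintegral_add_le_of_normalized {f g h : ℝ → ℝ} (hf : Measurable f) (hg : Measurable g)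
    (hh : Measurable h) (hf0 : ∀ x, 0 ≤ f x) (hg0 : ∀ x, 0 ≤ g x) (hh0 : ∀ x, 0 ≤ h x)
    (hf1 : ∀ x, f x ≤ 1) (hg1 : ∀ x, g x ≤ 1)
    (hfs : ∀ t < 1, ∃ x, t < f x) (hgs : ∀ t < 1, ∃ x, t < g x)
    (hfg : ∀ x y, f x * g y ≤ h (2⁻¹ * (x + y)) ^ 2) :
    (∫⁻ x, .ofReal (f x)) + ∫⁻ x, .ofReal (g x) ≤ 2 * ∫⁻ x, .ofReal (h x) := by
  rw [lintegral_eq_lintegral_meas_lt _ (.of_forall hf0) hf.aemeasurable,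
    lintegral_eq_lintegral_meas_lt _ (.of_forall hg0) hg.aemeasurable,
    lintegral_eq_lintegral_meas_lt _ (.of_forall hh0) hh.aemeasurable,
    ← lintegral_const_mul' _ _ (by simp), ← lintegral_add_left]
  · refine setLIntegral_mono' measurableSet_Ioi fun t (ht : 0 < t) => ?_
    rcases lt_or_ge t 1 with h1 | h1
    · have := volume_add_le_of_add_subset (C := (fun x => 2⁻¹ * x) ⁻¹' {x | t < h x})
        (measurableSet_lt measurable_const hf) (measurableSet_lt measurable_const hg)
        (hfs t h1) (hgs t h1) ?_
      · refine this.trans_eq ?_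
        rw [Real.volume_preimage_mul_left (by norm_num)]
        simp
      · intro a (ha : t < f a) b (hb : t < g b)
        refine lt_of_pow_lt_pow_left₀ 2 (hh0 _) (lt_of_lt_of_le ?_ (hfg a b))
        nlinarith
    · simp [Set.eq_empty_of_forall_notMem (s := {a | t < f a}) fun x hx =>
        (hx.trans_le (hf1 x)).not_ge h1, Set.eq_empty_of_forall_notMem (s := {a | t < g a})
        fun x hx => (hx.trans_le (hg1 x)).not_ge h1]
  · exact Antitone.measurable fun s t hst => measure_mono fun x hx => lt_of_le_of_lt hst hx

lemma ENNReal.four_mul_le_sq_add (a b : ℝ≥0∞) : 4 * (a * b) ≤ (a + b) ^ 2 := by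
  by_cases ha : a = ∞
  · simp [ha]
  by_cases hb : b = ∞
  · simp [hb]
  lift a to NNReal using ha
  lift b to NNReal using hb
  norm_cast
  rw [← NNReal.coe_le_coe]
  push_cast
  nlinarith [sq_nonneg ((a:ℝ) - b)]

/-- One-dimensional Prékopa–Leindler inequality for midpoints. -/
lemma lintegral_mul_lintegral_le_sq {f g h : ℝ → ℝ≥0∞} (hf : Measurable f) (hg : Measurable g)
    (hh : Measurable h) {c : ℝ≥0∞} (hc : c ≠ ∞) (hfc : ∀ x, f x ≤ c) (hgc : ∀ x, g x ≤ c)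
    (hfg : ∀ x y, f x * g y ≤ h (2⁻¹ * (x + y)) ^ 2) :
    (∫⁻ x, f x) * (∫⁻ x, g x) ≤ (∫⁻ x, h x) ^ 2 := by
  set a := ⨆ x, f x with ha
  set b := ⨆ x, g x with hb
  have hac : a ≠ ∞ := ne_top_of_le_ne_top hc (iSup_le hfc)
  have hbc : b ≠ ∞ := ne_top_of_le_ne_top hc (iSup_le hgc)
  have hfa : ∀ x, f x ≤ a := le_iSup f
  have hgb : ∀ x, g x ≤ b := le_iSup g
  by_cases ha0 : a = 0
  · simp [show ∀ x, f x = 0 from fun x => by simpa [ha0] using hfa x]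
  by_cases hb0 : b = 0
  · simp [show ∀ x, g x = 0 from fun x => by simpa [hb0] using hgb x]
  obtain ⟨r, hr⟩ : ∃ r : ℝ≥0∞, r ^ 2 = a * b :=
    ⟨(a * b) ^ (2⁻¹ : ℝ), by rw [← ENNReal.rpow_natCast, ← ENNReal.rpow_mul]; simp⟩
  have hfin : ∀ x, f x / a ≤ 1 := fun x => ENNReal.div_le_of_le_mul (by simpa using hfa x)
  have hgin : ∀ x, g x / b ≤ 1 := fun x => ENNReal.div_le_of_le_mul (by simpa using hgb x)
  have hsup : ∀ (u : ℝ → ℝ≥0∞) (s : ℝ≥0∞), s = ⨆ x, u x → s ≠ 0 → s ≠ ∞ → (∀ x, u x / s ≤ 1) →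
      ∀ t : ℝ, t < 1 → ∃ x, t < (u x / s).toReal := by
    intro u s hs hs0 hst hus t ht
    rcases lt_or_ge t 0 with h0 | h0
    · exact ⟨0, h0.trans_le ENNReal.toReal_nonneg⟩
    have : ENNReal.ofReal t * s < ⨆ x, u x := by
      rw [← hs]
      calc _ < 1 * s := by
            rw [ENNReal.mul_lt_mul_iff_left hs0 hst]
            simpa using ht
        _ = s := one_mul s
    obtain ⟨x, hx⟩ := lt_iSup_iff.1 this
    refine ⟨x, (ENNReal.ofReal_lt_iff_lt_toReal h0 (ne_top_of_le_ne_top (by simp) (hus x))).1 ?_⟩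
    rwa [ENNReal.lt_div_iff_mul_lt (.inl hs0) (.inl hst)]
  have hof : ∀ y : ℝ≥0∞, y ≤ 1 → ENNReal.ofReal y.toReal = y := fun y hy =>
    ENNReal.ofReal_toReal (ne_top_of_le_ne_top (by simp) hy)
  have key := lintegral_add_le_of_normalized (f := fun x => (f x / a).toReal)
    (g := fun x => (g x / b).toReal) (h := fun x => (min (h x / r) 1).toReal)
    (by fun_prop) (by fun_prop) (by fun_prop) (fun _ => ENNReal.toReal_nonneg)
    (fun _ => ENNReal.toReal_nonneg) (fun _ => ENNReal.toReal_nonneg)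
    (fun x => ENNReal.toReal_le_of_le_ofReal (by simp) (by simpa using hfin x))
    (fun x => ENNReal.toReal_le_of_le_ofReal (by simp) (by simpa using hgin x))
    (hsup f a ha ha0 hac hfin) (hsup g b hb hb0 hbc hgin) (by
      intro x y
      rw [← ENNReal.toReal_mul, ← ENNReal.toReal_pow]
      refine ENNReal.toReal_mono (ENNReal.pow_ne_top (by simp)) ?_
      rcases le_total (h (2⁻¹ * (x + y)) / r) 1 with h1 | h1
      · rw [min_eq_left h1, div_eq_mul_inv, div_eq_mul_inv, div_eq_mul_inv, mul_pow,
          ← ENNReal.inv_pow, hr, ENNReal.mul_inv (.inl ha0) (.inl hac)]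
        calc _ = f x * g y * (a⁻¹ * b⁻¹) := by ring
          _ ≤ _ := by gcongr; exact hfg x y
      · rw [min_eq_right h1, one_pow]
        exact mul_le_one' (hfin x) (hgin y))
  simp only [hof _ (hfin _), hof _ (hgin _), hof _ (min_le_right _ _)] at key
  have key2 : (∫⁻ x, f x / a) * (∫⁻ x, g x / b) ≤ (∫⁻ x, h x / r) ^ 2 := by
    have h4 := ENNReal.four_mul_le_sq_add (∫⁻ x, f x / a) (∫⁻ x, g x / b)
    have h5 : 4 * ((∫⁻ x, f x / a) * (∫⁻ x, g x / b)) ≤ 4 * (∫⁻ x, h x / r) ^ 2 := by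
      calc _ ≤ _ := h4
        _ ≤ (2 * ∫⁻ x, h x / r) ^ 2 := by
          gcongr
          refine key.trans ?_
          gcongr
          exact min_le_left _ _
        _ = _ := by ring
    exact (ENNReal.mul_le_mul_iff_right (by simp) (by simp)).1 h5
  simp only [div_eq_mul_inv] at key2
  rw [lintegral_mul_const _ hf, lintegral_mul_const _ hg, lintegral_mul_const _ hh, mul_pow,
    ← ENNReal.inv_pow, hr, ENNReal.mul_inv (.inl ha0) (.inl hac)] at key2
  have h6 : ((∫⁻ x, f x) * (∫⁻ x, g x)) * (a⁻¹ * b⁻¹) ≤ (∫⁻ x, h x) ^ 2 * (a⁻¹ * b⁻¹) := by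
    calc _ = _ := by ring
      _ ≤ _ := key2
  exact (ENNReal.mul_le_mul_iff_left (by simp [hac, hbc])
    (ENNReal.mul_ne_top (by simpa) (by simpa))).1 h6

/-- A midpoint Prékopa–Leindler property of a measure `ν` with quadratic gain `q`. -/
def IsGaussianLogConcave {E : Type*} [AddCommGroup E] [Module ℝ E] [MeasurableSpace E]
    (ν : Measure E) (q : E → ℝ) : Prop :=
  ∀ (f g h : E → ℝ≥0∞) (c : ℝ≥0∞), Measurable f → Measurable g → Measurable h → c ≠ ∞ →
    (∀ x, f x ≤ c) → (∀ x, g x ≤ c) →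
    (∀ x y, f x * g y ≤ .ofReal (Real.exp (q (x - y) / 4)) * h ((2⁻¹ : ℝ) • (x + y)) ^ 2) →
    (∫⁻ x, f x ∂ν) * (∫⁻ x, g x ∂ν) ≤ (∫⁻ x, h x ∂ν) ^ 2

namespace IsGaussianLogConcave

variable {E F : Type*} [AddCommGroup E] [Module ℝ E] [MeasurableSpace E]
  [AddCommGroup F] [Module ℝ F] [MeasurableSpace F]

lemma map {ν : Measure E} {q : E → ℝ} (hν : IsGaussianLogConcave ν q) {q' : F → ℝ}
    (T : E →ₗ[ℝ] F) (hT : Measurable T) (hq : ∀ x, q' (T x) ≤ q x) :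
    IsGaussianLogConcave (ν.map T) q' := by
  intro f g h c hf hg hh hc hfc hgc hfg
  rw [lintegral_map hf hT, lintegral_map hg hT, lintegral_map hh hT]
  refine hν _ _ _ c (hf.comp hT) (hg.comp hT) (hh.comp hT) hc (fun x => hfc _) (fun x => hgc _) ?_
  intro x y
  refine (hfg _ _).trans ?_
  rw [← map_sub, ← map_add, ← map_smul]
  gcongr
  exact hq _

lemma prod {ν : Measure E} {ν' : Measure F} [IsProbabilityMeasure ν] [IsProbabilityMeasure ν']
    {q : E → ℝ} {q' : F → ℝ} (hν : IsGaussianLogConcave ν q) (hν' : IsGaussianLogConcave ν' q') :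
    IsGaussianLogConcave (ν.prod ν') (fun z => q z.1 + q' z.2) := by
  intro f g h c hf hg hh hc hfc hgc hfg
  rw [lintegral_prod _ hf.aemeasurable, lintegral_prod _ hg.aemeasurable,
    lintegral_prod _ hh.aemeasurable]
  have hbound : ∀ (u : E × F → ℝ≥0∞), (∀ z, u z ≤ c) → ∀ x, ∫⁻ y, u (x, y) ∂ν' ≤ c := by
    intro u hu x
    calc _ ≤ ∫⁻ _, c ∂ν' := lintegral_mono fun y => hu _
      _ = c := by simp
  refine hν _ _ _ c hf.lintegral_prod_right' hg.lintegral_prod_right' hh.lintegral_prod_right' hc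
    (hbound f hfc) (hbound g hgc) ?_
  intro x x'
  set s := Real.exp (q (x - x') / 8) with hs
  have hs2 : ENNReal.ofReal s ^ 2 = .ofReal (Real.exp (q (x - x') / 4)) := by
    rw [← ENNReal.ofReal_pow (Real.exp_pos _).le, ← Real.exp_nat_mul]
    congr 2
    push_cast
    ring
  rw [← hs2, ← mul_pow, ← lintegral_const_mul (ENNReal.ofReal s) (by fun_prop)]
  refine hν' (fun y => f (x, y)) (fun y => g (x', y))
    (fun y => ENNReal.ofReal s * h ((2⁻¹ : ℝ) • (x + x'), y)) c (by fun_prop) (by fun_prop)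
    (by fun_prop) hc (fun y => hfc _)
    (fun y => hgc _) ?_
  intro y y'
  refine (hfg _ _).trans_eq ?_
  rw [mul_pow, hs2, ← mul_assoc, ← ENNReal.ofReal_mul (Real.exp_pos _).le, ← Real.exp_add]
  simp only [Prod.mk_sub_mk, Prod.mk_add_mk, Prod.smul_mk]
  congr 3
  ring

lemma of_subsingleton [Subsingleton E] {ν : Measure E} {q : E → ℝ} (hq : q 0 = 0) :
    IsGaussianLogConcave ν q := by
  intro f g h c hf hg hh hc hfc hgc hfg
  have hconst : ∀ u : E → ℝ≥0∞, ∫⁻ x, u x ∂ν = u 0 * ν Set.univ := by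
    intro u
    rw [lintegral_congr (g := fun _ => u 0) fun x => by rw [Subsingleton.elim x 0],
      lintegral_const]
  rw [hconst, hconst, hconst, mul_pow]
  have := hfg 0 0
  simp only [sub_zero, add_zero, smul_zero, hq, zero_div, Real.exp_zero, ENNReal.ofReal_one,
    one_mul] at this
  calc _ = f 0 * g 0 * ν Set.univ ^ 2 := by ring
    _ ≤ _ := by gcongr

end IsGaussianLogConcave

lemma isGaussianLogConcave_gaussianReal :
    IsGaussianLogConcave (gaussianReal 0 1) (fun x => x ^ 2) := by
  intro f g h c hf hg hh hc hfc hgc hfg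
  have hm := measurable_gaussianPDF 0 1
  rw [gaussianReal_of_var_ne_zero 0 one_ne_zero,
    lintegral_withDensity_eq_lintegral_mul _ hm hf, lintegral_withDensity_eq_lintegral_mul _ hm hg,
    lintegral_withDensity_eq_lintegral_mul _ hm hh]
  have hpdf : ∀ x, gaussianPDF 0 1 x = .ofReal ((√(2 * Real.pi))⁻¹ * Real.exp (-x ^ 2 / 2)) := by
    intro x
    simp [gaussianPDF, gaussianPDFReal]
  set k := (√(2 * Real.pi))⁻¹ with hk
  have hk0 : 0 ≤ k := by positivity
  have hle : ∀ u : ℝ → ℝ≥0∞, (∀ x, u x ≤ c) → ∀ x, (gaussianPDF 0 1 * u) x ≤ .ofReal k * c := by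
    intro u hu x
    rw [Pi.mul_apply, hpdf]
    gcongr
    · refine mul_le_of_le_one_right hk0 (Real.exp_le_one_iff.2 ?_)
      nlinarith [sq_nonneg x]
    · exact hu x
  refine lintegral_mul_lintegral_le_sq (hm.mul hf) (hm.mul hg) (hm.mul hh)
    (ENNReal.mul_ne_top ENNReal.ofReal_ne_top hc) (hle f hfc) (hle g hgc) ?_
  intro x y
  simp only [Pi.mul_apply]
  calc gaussianPDF 0 1 x * f x * (gaussianPDF 0 1 y * g y)
      = gaussianPDF 0 1 x * gaussianPDF 0 1 y * (f x * g y) := by ring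
    _ ≤ gaussianPDF 0 1 x * gaussianPDF 0 1 y *
        (.ofReal (Real.exp ((x - y) ^ 2 / 4)) * h (2⁻¹ * (x + y)) ^ 2) := by
      exact mul_le_mul_right (hfg x y) _
    _ = (gaussianPDF 0 1 (2⁻¹ * (x + y)) * h (2⁻¹ * (x + y))) ^ 2 := by
      rw [mul_pow, ← mul_assoc]
      congr 1
      rw [hpdf, hpdf, hpdf, ← ENNReal.ofReal_mul (by positivity),
        ← ENNReal.ofReal_mul (by positivity), ← ENNReal.ofReal_pow (by positivity)]
      congr 1
      rw [mul_pow, ← Real.exp_nat_mul]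
      calc _ = k ^ 2 * (Real.exp (-x ^ 2 / 2) * Real.exp (-y ^ 2 / 2) *
            Real.exp ((x - y) ^ 2 / 4)) := by ring
        _ = _ := by
          rw [← Real.exp_add, ← Real.exp_add]
          congr 2
          push_cast
          ring

lemma isGaussianLogConcave_pi (n : ℕ) :
    IsGaussianLogConcave (Measure.pi fun _ : Fin n => gaussianReal 0 1)
      (fun x => ∑ i, x i ^ 2) := by
  induction n with
  | zero => exact .of_subsingleton (by simp)
  | succ n ih =>
    have h := (measurePreserving_piFinSuccAbove (fun _ : Fin (n + 1) => gaussianReal 0 1) 0).symm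
    have he : ⇑(MeasurableEquiv.piFinSuccAbove (fun _ : Fin (n + 1) => ℝ) 0).symm =
        (Fin.consLinearEquiv ℝ (fun _ : Fin (n + 1) => ℝ)).toLinearMap := by
      ext x i
      simp
    have hm := h.measurable
    have hmap := h.map_eq
    rw [he] at hm hmap
    rw [← hmap]
    refine (isGaussianLogConcave_gaussianReal.prod ih).map _ hm ?_
    intro x
    simp [Fin.sum_univ_succ]

lemma isGaussianLogConcave_stdGaussian (n : ℕ) :
    IsGaussianLogConcave (stdGaussian (EuclideanSpace ℝ (Fin n))) (fun x => ‖x‖ ^ 2) := by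
  rw [← map_pi_eq_stdGaussian]
  refine (isGaussianLogConcave_pi n).map (WithLp.linearEquiv 2 ℝ (Fin n → ℝ)).symm.toLinearMap
    (by change Measurable (WithLp.toLp 2); fun_prop) ?_
  intro x
  simp [EuclideanSpace.real_norm_sq_eq]

open scoped RealInnerProductSpace Matrix MatrixOrder in
lemma exists_eq_map_stdGaussian {n : ℕ} (ν : Measure (EuclideanSpace ℝ (Fin n))) [IsGaussian ν]
    (h0 : ν[id] = 0) : ∃ A : EuclideanSpace ℝ (Fin n) →L[ℝ] EuclideanSpace ℝ (Fin n),
      ν = (stdGaussian _).map A := by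
  set b := (EuclideanSpace.basisFun (Fin n) ℝ) with hb
  set S : Matrix (Fin n) (Fin n) ℝ := Matrix.of fun i j => covarianceBilin ν (b i) (b j) with hS
  have hq : ∀ x y : EuclideanSpace ℝ (Fin n), covarianceBilin ν x y = x ⬝ᵥ S *ᵥ y := by
    intro x y
    conv_lhs => rw [← b.sum_repr x, ← b.sum_repr y]
    simp [hS, b, dotProduct, Matrix.mulVec, Finset.mul_sum, mul_comm, mul_left_comm]
    exact Finset.sum_comm
  have hpos : S.PosSemidef := by
    refine .of_dotProduct_mulVec_nonneg ?_ ?_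
    · ext i j
      simp [hS, covarianceBilin_comm]
    · intro x
      have := covarianceBilin_self_nonneg (μ := ν) (WithLp.toLp 2 x)
      rw [hq] at this
      simpa using this
  refine ⟨Matrix.toEuclideanCLM (𝕜 := ℝ) (CFC.sqrt S), ?_⟩
  suffices ν = multivariateGaussian 0 S by simpa [multivariateGaussian] using this
  refine IsGaussian.ext (by simpa using h0) ?_
  ext x y
  rw [hq, covarianceBilin_multivariateGaussian hpos]

lemma IsGaussianLogConcave.of_isGaussian {n : ℕ} (ν : Measure (EuclideanSpace ℝ (Fin n)))
    [IsGaussian ν] (h0 : ν[id] = 0) (L : EuclideanSpace ℝ (Fin n) →L[ℝ] ℝ) {v : ℝ} (hv : 0 < v)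
    (hL : Var[L; ν] ≤ v) : IsGaussianLogConcave ν (fun x => L x ^ 2 / v) := by
  obtain ⟨A, rfl⟩ := exists_eq_map_stdGaussian ν h0
  rw [variance_map (by fun_prop) (by fun_prop)] at hL
  change Var[L.comp A; _] ≤ v at hL
  rw [variance_dual_stdGaussian] at hL
  refine (isGaussianLogConcave_stdGaussian n).map A.toLinearMap
    (by change Measurable A; fun_prop) ?_
  intro x
  rw [div_le_iff₀ hv]
  change (L.comp A x) ^ 2 ≤ _
  calc (L.comp A x) ^ 2 = ‖L.comp A x‖ ^ 2 := by simp
    _ ≤ (‖L.comp A‖ * ‖x‖) ^ 2 := by gcongr; exact (L.comp A).le_opNorm x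
    _ = ‖L.comp A‖ ^ 2 * ‖x‖ ^ 2 := by ring
    _ ≤ v * ‖x‖ ^ 2 := by gcongr
    _ = _ := by ring

lemma IsGaussianLogConcave.measure_mul_measure_le {E : Type*} [AddCommGroup E] [Module ℝ E]
    [MeasurableSpace E] {ν : Measure E} {q : E → ℝ} (hν : IsGaussianLogConcave ν q)
    {A B C : Set E} (hA : MeasurableSet A) (hB : MeasurableSet B) (hC : MeasurableSet C) {s : ℝ}
    (hABC : ∀ a ∈ A, ∀ b ∈ B, (2⁻¹ : ℝ) • (a + b) ∈ C) (hs : ∀ a ∈ A, ∀ b ∈ B, s ≤ q (a - b) / 4) :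
    ENNReal.ofReal (Real.exp s) * (ν A * ν B) ≤ ν C ^ 2 := by
  have h := hν (A.indicator fun _ => ENNReal.ofReal (Real.exp s)) (B.indicator 1) (C.indicator 1)
    (max (ENNReal.ofReal (Real.exp s)) 1) (measurable_const.indicator hA)
    (measurable_one.indicator hB) (measurable_one.indicator hC) (by simp)
    (fun x => (Set.indicator_le_self' (by simp) x).trans (le_max_left _ _))
    (fun x => (Set.indicator_le_self' (by simp) x).trans (le_max_right _ _)) ?_
  · rwa [lintegral_indicator_const hA, lintegral_indicator_one hB, lintegral_indicator_one hC,
      mul_assoc] at h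
  · intro a b
    by_cases ha : a ∈ A
    · by_cases hb : b ∈ B
      · simp only [Set.indicator_of_mem ha, Set.indicator_of_mem hb,
          Set.indicator_of_mem (hABC a ha b hb), Pi.one_apply, mul_one, one_pow]
        gcongr
        exact hs a ha b hb
      · simp [hb]
    · simp [ha]

section Gaussian

variable {X : Type*} [NormedAddCommGroup X] [NormedSpace ℝ X]

lemma exists_norming_seq [TopologicalSpace.SeparableSpace X] (ℓ : X →L[ℝ] ℝ) (hℓ : ‖ℓ‖ ≤ 1) :
    ∃ D : ℕ → X →L[ℝ] ℝ, D 0 = ℓ ∧ ∀ x r, ‖x‖ ≤ r ↔ ∀ k, |D k x| ≤ r := by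
  choose g hg1 hg2 using fun x : X => exists_dual_vector'' ℝ x
  refine ⟨fun k => Nat.casesOn k ℓ fun k => g (TopologicalSpace.denseSeq X k), rfl, ?_⟩
  intro x r
  constructor
  · rintro hx (_ | k)
    · exact (ℓ.le_of_opNorm_le hℓ x).trans (by simpa using hx)
    · exact ((g _).le_of_opNorm_le (hg1 _) x).trans (by simpa using hx)
  · intro h
    refine le_of_forall_pos_le_add fun ε hε => ?_
    obtain ⟨k, hk⟩ := (TopologicalSpace.denseRange_denseSeq X).exists_dist_lt x (half_pos hε)
    set u := TopologicalSpace.denseSeq X k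
    have h1 := h (k + 1)
    change |g u x| ≤ r at h1
    have h2 : ‖g u (u - x)‖ ≤ 1 * ‖u - x‖ := (g u).le_of_opNorm_le (hg1 u) _
    have h3 : g u u = ‖u‖ := hg2 u
    rw [dist_eq_norm] at hk
    have h4 : ‖x‖ ≤ ‖u‖ + ‖x - u‖ := by
      simpa using norm_add_le u (x - u)
    rw [map_sub, h3, Real.norm_eq_abs, norm_sub_rev] at h2
    have := le_abs_self (‖u‖ - g u x)
    have := le_abs_self (g u x)
    linarith

variable [MeasurableSpace X] [BorelSpace X] {μ : Measure X} [IsGaussian μ]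

lemma cylinder_mul_cylinder_le [CompleteSpace X] [SecondCountableTopology X] (h0 : μ[id] = 0)
    (D : ℕ → X →L[ℝ] ℝ) {v : ℝ} (hv : 0 < v) (hD : Var[D 0; μ] ≤ v) (x y : X) (δ : ℝ) (n : ℕ) :
    ENNReal.ofReal (Real.exp (max 0 (D 0 (x - y) - 2 * δ) ^ 2 / (4 * v))) *
      (μ {u | ∀ k < n + 1, |D k (u - x)| ≤ δ} * μ {u | ∀ k < n + 1, |D k (u - y)| ≤ δ}) ≤
      μ {u | ∀ k < n + 1, |D k (u - (2⁻¹ : ℝ) • (x + y))| ≤ δ} ^ 2 := by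
  set T : X →L[ℝ] EuclideanSpace ℝ (Fin (n + 1)) :=
    (EuclideanSpace.equiv (Fin (n + 1)) ℝ).symm.toContinuousLinearMap.comp
      (ContinuousLinearMap.pi fun i : Fin (n + 1) => D i) with hT
  have hTi : ∀ u i, T u i = D i u := fun u i => rfl
  have hTm : Measurable T := by fun_prop
  set box : EuclideanSpace ℝ (Fin (n + 1)) → Set (EuclideanSpace ℝ (Fin (n + 1))) :=
    fun z => {w | ∀ i, |w i - z i| ≤ δ} with hbox
  have hbm : ∀ z, MeasurableSet (box z) := by
    intro z
    have : box z = ⋂ i, {w | |w i - z i| ≤ δ} := by ext; simp [hbox]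
    rw [this]
    exact MeasurableSet.iInter fun i => measurableSet_le (by fun_prop) measurable_const
  have hcyl : ∀ x, {u | ∀ k < n + 1, |D k (u - x)| ≤ δ} = T ⁻¹' box (T x) := by
    intro x
    ext u
    simp only [hbox, Set.mem_ofPred_eq, Set.mem_preimage, hTi, map_sub, Fin.forall_iff]
  rw [hcyl, hcyl, hcyl, ← Measure.map_apply hTm (hbm _), ← Measure.map_apply hTm (hbm _),
    ← Measure.map_apply hTm (hbm _)]
  have hmean : (μ.map T)[id] = 0 := by
    have := ContinuousLinearMap.integral_id_map (μ := μ) IsGaussian.integrable_id T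
    simp only [id_eq] at this h0 ⊢
    rw [this, h0, map_zero]
  refine (IsGaussianLogConcave.of_isGaussian (μ.map T) hmean (EuclideanSpace.proj 0) hv
    ?_).measure_mul_measure_le (hbm _) (hbm _) (hbm _) ?_ ?_
  · rw [variance_map (by fun_prop) (by fun_prop)]
    exact hD
  · intro a ha b hb i
    have h1 := abs_le.1 (ha i)
    have h2 := abs_le.1 (hb i)
    rw [hTi] at h1 h2 ⊢
    simp only [PiLp.smul_apply, PiLp.add_apply, map_smul, map_add, smul_eq_mul]
    rw [abs_le]
    constructor <;> linarith
  · intro a ha b hb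
    have h1 := abs_le.1 (ha 0)
    have h2 := abs_le.1 (hb 0)
    rw [hTi] at h1 h2
    have hab : EuclideanSpace.proj (𝕜 := ℝ) 0 (a - b) = a 0 - b 0 := rfl
    rw [hab, map_sub, div_div, mul_comm v 4]
    gcongr ?_ / _
    simp only [Fin.val_zero] at h1 h2
    rcases le_total (D 0 x - D 0 y - 2 * δ) 0 with h | h
    · rw [max_eq_left h]
      nlinarith [sq_nonneg (a 0 - b 0)]
    · rw [max_eq_right h]
      exact pow_le_pow_left₀ h (by linarith) 2

lemma closedBall_mul_closedBall_le [CompleteSpace X] [SecondCountableTopology X] (h0 : μ[id] = 0)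
    (ℓ : X →L[ℝ] ℝ) (hℓ : ‖ℓ‖ ≤ 1) {v : ℝ} (hv : 0 < v) (hvar : Var[ℓ; μ] ≤ v) (x y : X) (δ : ℝ) :
    ENNReal.ofReal (Real.exp (max 0 (ℓ (x - y) - 2 * δ) ^ 2 / (4 * v))) *
      (μ (closedBall x δ) * μ (closedBall y δ)) ≤ μ (closedBall ((2⁻¹ : ℝ) • (x + y)) δ) ^ 2 := by
  obtain ⟨D, rfl, hD⟩ := exists_norming_seq ℓ hℓ
  set cyl : X → ℕ → Set X := fun x n => {u | ∀ k < n + 1, |D k (u - x)| ≤ δ} with hcyl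
  have hsub : ∀ x n, closedBall x δ ⊆ cyl x n := fun x n u hu k _ =>
    (hD _ _).1 (mem_closedBall_iff_norm.1 hu) k
  have hInter : ∀ x, closedBall x δ = ⋂ n, cyl x n := by
    intro x
    refine subset_antisymm (Set.subset_iInter (hsub x)) fun u hu => ?_
    rw [mem_closedBall_iff_norm, hD]
    exact fun k => Set.mem_iInter.1 hu k k (Nat.lt_succ_self k)
  have hanti : ∀ x, Antitone (cyl x) := fun x m n hmn u hu k hk => hu k (by omega)
  have hmeas : ∀ x n, MeasurableSet (cyl x n) := by
    intro x n
    have : cyl x n = ⋂ k, ⋂ _ : k < n + 1, {u | |D k (u - x)| ≤ δ} := by ext; simp [hcyl]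
    rw [this]
    exact MeasurableSet.iInter fun k => MeasurableSet.iInter fun _ =>
      measurableSet_le (by fun_prop) measurable_const
  have hlim := tendsto_measure_iInter_atTop (μ := μ)
    (fun n => (hmeas ((2⁻¹ : ℝ) • (x + y)) n).nullMeasurableSet) (hanti _) ⟨0, by simp⟩
  rw [← hInter] at hlim
  refine ge_of_tendsto' (ENNReal.Tendsto.pow (n := 2) hlim) fun n => ?_
  refine le_trans ?_ (cylinder_mul_cylinder_le h0 D hv hvar x y δ n)
  gcongr
  · exact hsub x n
  · exact hsub y n

lemma ball_mul_ball_le [CompleteSpace X] [SecondCountableTopology X] (h0 : μ[id] = 0)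
    (ℓ : X →L[ℝ] ℝ) (hℓ : ‖ℓ‖ ≤ 1) {v : ℝ} (hv : 0 < v) (hvar : Var[ℓ; μ] ≤ v) (x y : X) (δ : ℝ) :
    ENNReal.ofReal (Real.exp (max 0 (ℓ (x - y) - 2 * δ) ^ 2 / (4 * v))) *
      (μ (ball x δ) * μ (ball y δ)) ≤ μ (ball ((2⁻¹ : ℝ) • (x + y)) δ) ^ 2 := by
  obtain ⟨r, hr, hrδ, hrlim⟩ := exists_seq_strictMono_tendsto δ
  have hlim : ∀ z, Tendsto (fun n => μ (closedBall z (r n))) atTop (𝓝 (μ (ball z δ))) := by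
    intro z
    have hU : ball z δ = ⋃ n, closedBall z (r n) := by
      ext u
      simp only [mem_ball, Set.mem_iUnion, mem_closedBall]
      constructor
      · intro hu
        obtain ⟨n, hn⟩ := (hrlim.eventually (lt_mem_nhds hu)).exists
        exact ⟨n, hn.le⟩
      · rintro ⟨n, hn⟩
        exact hn.trans_lt (hrδ n)
    rw [hU]
    exact tendsto_measure_iUnion_atTop fun m n hmn => closedBall_subset_closedBall (hr.monotone hmn)
  refine le_of_tendsto' (ENNReal.Tendsto.const_mul (ENNReal.Tendsto.mul (hlim x)
    (.inr (measure_ne_top _ _)) (hlim y) (.inr (measure_ne_top _ _)))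
    (.inr ENNReal.ofReal_ne_top)) fun n => ?_
  have h := closedBall_mul_closedBall_le h0 ℓ hℓ hv hvar x y (r n)
  refine le_trans ?_ (h.trans ?_)
  · gcongr
    exact (hrδ n).le
  · gcongr
    exact closedBall_subset_ball (hrδ n)

lemma measure_ball_neg [CompleteSpace X] [SecondCountableTopology X] (h0 : μ[id] = 0) (x : X)
    (δ : ℝ) : μ (ball (-x) δ) = μ (ball x δ) := by
  have hmap : μ.map (-ContinuousLinearMap.id ℝ X) = μ := by
    refine Measure.ext_of_charFunDual ?_
    ext L
    rw [charFunDual_map, IsGaussian.charFunDual_eq_of_integral_eq_zero h0,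
      IsGaussian.charFunDual_eq_of_integral_eq_zero h0]
    have : (L.comp (-ContinuousLinearMap.id ℝ X) : X → ℝ) = fun u => -L u := by ext; simp
    rw [this, variance_fun_neg]
  conv_rhs => rw [← hmap, Measure.map_apply (by fun_prop) measurableSet_ball]
  congr 1
  ext u
  simp only [mem_ball, Set.mem_preimage, dist_eq_norm]
  rw [← norm_neg]
  simp [sub_eq_add_neg, add_comm]

/-- Quantitative Anderson inequality for balls under a centered Gaussian measure. -/
lemma exp_mul_measure_ball_le [CompleteSpace X] [SecondCountableTopology X] (h0 : μ[id] = 0)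
    (ℓ : X →L[ℝ] ℝ) (hℓ : ‖ℓ‖ ≤ 1) {v : ℝ} (hv : 0 < v) (hvar : Var[ℓ; μ] ≤ v) (x : X) (δ : ℝ) :
    Real.exp (max 0 (ℓ x - δ) ^ 2 / (2 * v)) * μ.real (ball x δ) ≤ μ.real (ball 0 δ) := by
  have h := ball_mul_ball_le h0 ℓ hℓ hv hvar x (-x) δ
  rw [measure_ball_neg h0, add_neg_cancel, smul_zero] at h
  have h' := ENNReal.toReal_mono (ENNReal.pow_ne_top (measure_ne_top _ _)) h
  rw [ENNReal.toReal_mul, ENNReal.toReal_mul, ENNReal.toReal_pow,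
    ENNReal.toReal_ofReal (Real.exp_pos _).le] at h'
  refine le_of_sq_le_sq ?_ measureReal_nonneg
  refine le_trans (le_of_eq ?_) h'
  have hmax : max 0 (ℓ (x - -x) - 2 * δ) = 2 * max 0 (ℓ x - δ) := by
    rw [mul_max_of_nonneg _ _ zero_le_two, mul_zero, sub_neg_eq_add, map_add]
    congr 1
    ring
  rw [hmax, mul_pow, ← Real.exp_nat_mul, sq (μ.real _)]
  congr 2
  push_cast
  field_simp
  ring

lemma measure_ball_le_measure_ball_zero [CompleteSpace X] [SecondCountableTopology X]
    (h0 : μ[id] = 0) (x : X) (δ : ℝ) : μ.real (ball x δ) ≤ μ.real (ball 0 δ) := by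
  refine le_trans ?_ (exp_mul_measure_ball_le h0 0 (by simp) one_pos (by simp) x δ)
  refine le_mul_of_one_le_left measureReal_nonneg (Real.one_le_exp (by positivity))

lemma measure_ball_zero_pos [CompleteSpace X] [SecondCountableTopology X]
    (h0 : μ[id] = 0) {δ : ℝ} (hδ : 0 < δ) : 0 < μ.real (ball 0 δ) := by
  refine measureReal_nonneg.lt_of_ne' fun h => ?_
  have hz : ∀ x, μ (ball x δ) = 0 := fun x =>
    (measureReal_eq_zero_iff).1 (le_antisymm (h ▸ measure_ball_le_measure_ball_zero h0 x δ)
      measureReal_nonneg)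
  have : μ (⋃ k, ball (TopologicalSpace.denseSeq X k) δ) = 0 :=
    measure_iUnion_null fun k => hz _
  have hu : ⋃ k, ball (TopologicalSpace.denseSeq X k) δ = Set.univ :=
    Set.eq_univ_of_forall fun x => Set.mem_iUnion.2
      ((TopologicalSpace.denseRange_denseSeq X).exists_dist_lt x hδ)
  simp [hu] at this

lemma maxBallProb_eq [CompleteSpace X] [SecondCountableTopology X] (h0 : μ[id] = 0) (δ : ℝ) :
    maxBallProb μ δ = μ.real (ball 0 δ) :=
  le_antisymm (ciSup_le fun x => measure_ball_le_measure_ball_zero h0 x δ)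
    (le_ciSup (f := fun x => (μ (ball x δ)).toReal)
      ⟨μ.real (ball 0 δ), by rintro _ ⟨x, rfl⟩; exact measure_ball_le_measure_ball_zero h0 x δ⟩ 0)

lemma not_isGeneralizedMode_of_ne_zero [CompleteSpace X] [SecondCountableTopology X]
    (h0 : μ[id] = 0) {x : X} (hx : x ≠ 0) : ¬ IsGeneralizedMode μ x := by
  intro h
  have hδ0 := tendsto_one_div_add_atTop_nhds_zero_nat (𝕜 := ℝ)
  obtain ⟨w, hw, hlim⟩ := h (fun n => 1 / ((n : ℝ) + 1)) (fun n => by positivity) hδ0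
  obtain ⟨ℓ, hℓ, hℓx⟩ := exists_dual_vector'' ℝ x
  have hv : 0 < Var[ℓ; μ] + 1 := by linarith [variance_nonneg ℓ μ]
  have hlim' : Tendsto (fun n : ℕ => Real.exp (-(max 0 (ℓ (w n) - 1 / ((n : ℝ) + 1)) ^ 2 /
      (2 * (Var[ℓ; μ] + 1))))) atTop
      (𝓝 (Real.exp (-(max 0 (ℓ x - 0) ^ 2 / (2 * (Var[ℓ; μ] + 1)))))) :=
    (Real.continuous_exp.tendsto _).comp ((((tendsto_const_nhds.max
      (((ℓ.continuous.tendsto x).comp hw).sub hδ0)).pow 2).div_const _).neg)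
  have hle := le_of_tendsto_of_tendsto' hlim hlim' fun n => by
    have hpos : (0 : ℝ) < 1 / ((n : ℝ) + 1) := by positivity
    rw [maxBallProb_eq h0, div_le_iff₀ (measure_ball_zero_pos h0 hpos), Real.exp_neg,
      ← div_eq_inv_mul, le_div_iff₀' (Real.exp_pos _)]
    exact exp_mul_measure_ball_le h0 ℓ hℓ hv (by linarith) _ _
  have hnx : (0 : ℝ) < ‖x‖ := norm_pos_iff.2 hx
  have hℓx' : ℓ x = ‖x‖ := hℓx
  rw [Real.one_le_exp_iff, sub_zero, hℓx', max_eq_right hnx.le] at hle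
  have : 0 < ‖x‖ ^ 2 / (2 * (Var[ℓ; μ] + 1)) := by positivity
  linarith

end Gaussian

lemma IsStrongMode.isGeneralizedMode {X : Type*} [PseudoMetricSpace X] [MeasurableSpace X]
    {μ : Measure X} {x : X} (h : IsStrongMode μ x) : IsGeneralizedMode μ x := fun _ hpos hlim =>
  ⟨fun _ => x, tendsto_const_nhds,
    h.comp (tendsto_nhdsWithin_iff.2 ⟨hlim, .of_forall hpos⟩)⟩

namespace IsCenteredGaussianMeasure

variable {X : Type*} [NormedAddCommGroup X] [NormedSpace ℝ X] [MeasurableSpace X] [BorelSpace X]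
  {μ : Measure X}

lemma isGaussian (hμ : IsCenteredGaussianMeasure μ) : IsGaussian μ :=
  isGaussian_of_map_eq_gaussianReal fun L => ⟨0, hμ L⟩

lemma integral_id_eq_zero [CompleteSpace X] [SecondCountableTopology X]
    (hμ : IsCenteredGaussianMeasure μ) : μ[id] = 0 := by
  have := hμ.isGaussian
  refine SeparatingDual.eq_zero_of_forall_dual_eq_zero (R := ℝ) fun L => ?_
  obtain ⟨v, hv⟩ := hμ L
  simp only [id_eq]
  rw [← IsGaussian.integral_dual L, ← integral_id_gaussianReal (μ := 0) (v := v), ← hv,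
    integral_map (by fun_prop) (by fun_prop)]

end IsCenteredGaussianMeasure

theorem gaussian_modes {X : Type*} [NormedAddCommGroup X] [NormedSpace ℝ X]
    [CompleteSpace X] [TopologicalSpace.SeparableSpace X] [MeasurableSpace X] [BorelSpace X]
    (μ : Measure X) [IsProbabilityMeasure μ] (hμ : IsCenteredGaussianMeasure μ) :
    IsStrongMode μ 0 ∧ IsGeneralizedMode μ 0 ∧
      ∀ x : X, x ≠ 0 → ¬ IsStrongMode μ x ∧ ¬ IsGeneralizedMode μ x := by
  have : SecondCountableTopology X := UniformSpace.secondCountable_of_separable X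
  have := hμ.isGaussian
  have h0 := hμ.integral_id_eq_zero
  have hstrong : IsStrongMode μ 0 := by
    refine tendsto_const_nhds.congr' ?_
    filter_upwards [self_mem_nhdsWithin] with δ hδ
    rw [maxBallProb_eq h0]
    exact (div_self (measure_ball_zero_pos h0 hδ).ne').symm
  refine ⟨hstrong, hstrong.isGeneralizedMode, fun x hx => ?_⟩
  have hx' := not_isGeneralizedMode_of_ne_zero h0 hx
  exact ⟨fun h => hx' h.isGeneralizedMode, hx'⟩
end
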